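/- arXiv:1809.07248 — 7 statements merged into one kernel-verified Lean document; each statement's English description precedes it below -/
import Mathlib

section
/- Let n be a positive integer and let (p_1,q_1),...,(p_k,q_k) (k ≥ 1) be pairs of integers such that −n ≤ p_i ≤ n and 1 ≤ q_i ≤ n for every i ∈ {1,...,k}. Then there exists a pair (p,q) of integers with −n ≤ p ≤ n and 1 ≤ q ≤ n such that g_{(p,q)}(d) = min{ g_{(p_1,q_1)}(d), ..., g_{(p_k,q_k)}(d) } for every nonnegative integer d. -/
/-- The function `g_{(p,q)} : ℤ → ℤ` with `g_{(p,q)}(d) = 0` if `d ≤ p` and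
`g_{(p,q)}(d) = d - p + q - 1` if `d ≥ p + 1`. -/
def gfun (p q d : ℤ) : ℤ := if d ≤ p then 0 else d - p + q - 1

/-- Lemma 1: for pairs `(p_i, q_i)`, `i = 1, ..., k` (`k ≥ 1`), with `-n ≤ p_i ≤ n` and
`1 ≤ q_i ≤ n`, there is a single pair `(P, Q)` with `-n ≤ P ≤ n` and `1 ≤ Q ≤ n` such that
`g_{(P,Q)}(d) = min_i g_{(p_i,q_i)}(d)` for every nonnegative integer `d`. -/
theorem stmt0 (n : ℕ) (hn : 0 < n) (k : ℕ) (p q : Fin (k + 1) → ℤ)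
    (hp : ∀ i, -(n : ℤ) ≤ p i ∧ p i ≤ n) (hq : ∀ i, 1 ≤ q i ∧ q i ≤ n) :
    ∃ P Q : ℤ, -(n : ℤ) ≤ P ∧ P ≤ n ∧ 1 ≤ Q ∧ Q ≤ n ∧
      ∀ d : ℤ, 0 ≤ d →
        gfun P Q d = Finset.univ.inf' Finset.univ_nonempty (fun i => gfun (p i) (q i) d) := by
  obtain ⟨i, -, hi⟩ := Finset.exists_max_image Finset.univ p Finset.univ_nonempty
  obtain ⟨j, -, hj⟩ := Finset.exists_min_image Finset.univ (fun i => q i - p i)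
    Finset.univ_nonempty
  have hij := hi j (Finset.mem_univ j)
  have hji := hj i (Finset.mem_univ i)
  have hqi := hq i
  have hqj := hq j
  refine ⟨p i, q j - p j + p i, (hp i).1, (hp i).2, by omega, by omega, fun d _ => ?_⟩
  apply le_antisymm
  · refine Finset.le_inf' _ _ fun l hl => ?_
    have hil := hi l hl
    have hjl := hj l hl
    have hql := hq l
    unfold gfun
    split_ifs <;> omega
  · by_cases hd : d ≤ p i
    · refine (Finset.inf'_le _ (Finset.mem_univ i)).trans ?_
      simp [gfun, hd]
    · refine (Finset.inf'_le _ (Finset.mem_univ j)).trans ?_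
      unfold gfun
      split_ifs <;> omega
end

section
/- Let n be a positive integer and let (p_1,q_1),...,(p_k,q_k) (k ≥ 1) be pairs of integers such that −n ≤ p_i ≤ n and 1 ≤ q_i ≤ n for every i ∈ {1,...,k}. Set p = max{p_1,...,p_k} and q = min{ g_{(p_1,q_1)}(p+1), ..., g_{(p_k,q_k)}(p+1) }. Then −n ≤ p ≤ n, 1 ≤ q ≤ n, and g_{(p,q)}(d) = min{ g_{(p_1,q_1)}(d), ..., g_{(p_k,q_k)}(d) } for every nonnegative integer d. -/
/-- For pairs `(p_i, q_i)`, `i = 1, ..., k` (`k ≥ 1`), with `-n ≤ p_i ≤ n` and `1 ≤ q_i ≤ n`,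
setting `P = max_i p_i` and `Q = min_i g_{(p_i,q_i)}(P + 1)`, we have `-n ≤ P ≤ n`, `1 ≤ Q ≤ n`,
and `g_{(P,Q)}(d) = min_i g_{(p_i,q_i)}(d)` for every nonnegative integer `d`. -/
theorem stmt1 (n : ℕ) (hn : 0 < n) (k : ℕ) (p q : Fin (k + 1) → ℤ)
    (hp : ∀ i, -(n : ℤ) ≤ p i ∧ p i ≤ n) (hq : ∀ i, 1 ≤ q i ∧ q i ≤ n)
    (P Q : ℤ) (hP : P = Finset.univ.sup' Finset.univ_nonempty p)
    (hQ : Q = Finset.univ.inf' Finset.univ_nonempty (fun i => gfun (p i) (q i) (P + 1))) :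
    -(n : ℤ) ≤ P ∧ P ≤ n ∧ 1 ≤ Q ∧ Q ≤ n ∧
      ∀ d : ℤ, 0 ≤ d →
        gfun P Q d = Finset.univ.inf' Finset.univ_nonempty (fun i => gfun (p i) (q i) d) := by
  obtain ⟨i₀, -, h₀⟩ := Finset.exists_mem_eq_sup' Finset.univ_nonempty p
  obtain ⟨j, -, hj⟩ := Finset.exists_mem_eq_inf' Finset.univ_nonempty
    (fun i => gfun (p i) (q i) (P + 1))
  have hPi : P = p i₀ := hP.trans h₀
  have hQj : Q = gfun (p j) (q j) (P + 1) := hQ.trans hj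
  have p_le (i) : p i ≤ P := hP ▸ Finset.le_sup' p (Finset.mem_univ i)
  have Q_le (i) : Q ≤ gfun (p i) (q i) (P + 1) :=
    hQ ▸ Finset.inf'_le (fun i => gfun (p i) (q i) (P + 1)) (Finset.mem_univ i)
  have hp₀ := hp i₀
  have hq₀ := hq i₀
  have hqj := hq j
  have hpj := p_le j
  have hQ₀ := Q_le i₀
  simp only [gfun] at hQj hQ₀
  refine ⟨by omega, by omega, by grind, by grind, fun d _ => le_antisymm ?_ ?_⟩
  · refine Finset.le_inf' _ _ fun i _ => ?_
    have hqi := hq i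
    have hpi := p_le i
    have hQi := Q_le i
    simp only [gfun] at hQi ⊢
    grind
  · by_cases hd : d ≤ P
    · refine (Finset.inf'_le _ (Finset.mem_univ i₀)).trans ?_
      simp only [gfun]
      grind
    · refine (Finset.inf'_le _ (Finset.mem_univ j)).trans ?_
      simp only [gfun]
      grind
end

section
/- Let n be a positive integer and let p, q, f, and dist be integers such that −n ≤ p ≤ n and 1 ≤ q, f, dist ≤ n. Then g_{(p,q)}(d) ≤ g_{(f,f)}(d + dist) holds for every positive integer d if and only if max{ f − max{p, 0}, q − p } ≤ dist. -/
/-- Lemma 2: if `-n ≤ p ≤ n` and `q, f, dist ∈ [n]`, then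
`g_{(p,q)}(d) ≤ g_{(f,f)}(d + dist)` for every positive integer `d` if and only if
`max { f - max{p,0}, q - p } ≤ dist`. -/
theorem stmt3 (n : ℕ) (hn : 0 < n) (p q f dist : ℤ)
    (hp : -(n : ℤ) ≤ p ∧ p ≤ n) (hq : 1 ≤ q ∧ q ≤ n)
    (hf : 1 ≤ f ∧ f ≤ n) (hdist : 1 ≤ dist ∧ dist ≤ n) :
    (∀ d : ℤ, 0 < d → gfun p q d ≤ gfun f f (d + dist)) ↔
      max (f - max p 0) (q - p) ≤ dist := by
  constructor
  · intro h
    have h1 := h (max p 0 + 1) (by omega)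
    unfold gfun at h1
    split_ifs at h1 <;> omega
  · intro h d hd
    unfold gfun
    split_ifs <;> omega
end

section
/- If G is a finite connected graph with diameter two and independence number α(G) ≥ 3, then α_b(G) = α(G). -/
/-- The eccentricity of a vertex `x`: the maximum distance from `x` to any vertex. -/
noncomputable def ecc {V : Type*} (G : SimpleGraph V) (x : V) : ℕ := ⨆ y, G.dist x y

/-- An independent broadcast on `G`: `f x ≤ ecc_G(x)` for every vertex `x`, and
`dist_G(x,y) > max {f x, f y}` for distinct vertices `x, y` with `f x, f y > 0`. -/
def IsIndepBroadcast {V : Type*} (G : SimpleGraph V) (f : V → ℕ) : Prop :=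
  (∀ x, f x ≤ ecc G x) ∧
    ∀ x y, x ≠ y → 0 < f x → 0 < f y → max (f x) (f y) < G.dist x y

/-- The broadcast independence number: the maximum weight `∑ x, f x` of an
independent broadcast `f` on `G`. -/
noncomputable def broadcastIndepNum {V : Type*} [Fintype V] (G : SimpleGraph V) : ℕ :=
  sSup {w | ∃ f : V → ℕ, IsIndepBroadcast G f ∧ w = ∑ x, f x}

/-- An independent set of vertices: pairwise nonadjacent. -/
def IsIndepSet {V : Type*} (G : SimpleGraph V) (s : Finset V) : Prop :=
  ∀ x ∈ s, ∀ y ∈ s, x ≠ y → ¬ G.Adj x y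

/-- The independence number: the maximum cardinality of an independent set. -/
noncomputable def indepNum {V : Type*} [Fintype V] (G : SimpleGraph V) : ℕ :=
  sSup {k | ∃ s : Finset V, IsIndepSet G s ∧ s.card = k}

lemma IsIndepSet.card_le_indepNum {V : Type*} [Fintype V] {G : SimpleGraph V} {s : Finset V}
    (hs : IsIndepSet G s) : s.card ≤ indepNum G :=
  le_csSup ⟨Fintype.card V, by rintro k ⟨t, -, rfl⟩; exact t.card_le_univ⟩ ⟨s, hs, rfl⟩

lemma exists_isIndepSet_card_eq_indepNum {V : Type*} [Fintype V] (G : SimpleGraph V) :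
    ∃ s : Finset V, IsIndepSet G s ∧ s.card = indepNum G :=
  Nat.sSup_mem (s := {k | ∃ s : Finset V, IsIndepSet G s ∧ s.card = k})
    ⟨0, ∅, by simp [IsIndepSet], rfl⟩
    ⟨Fintype.card V, by rintro k ⟨t, -, rfl⟩; exact t.card_le_univ⟩

lemma dist_le_ecc {V : Type*} [Finite V] (G : SimpleGraph V) (x y : V) :
    G.dist x y ≤ ecc G x :=
  le_ciSup (f := fun z => G.dist x z) (Set.finite_range _).bddAbove y

/-- The indicator function of an independent set with at least two elements is an independent
broadcast. -/
lemma IsIndepSet.isIndepBroadcast_indicator {V : Type*} [Finite V] {G : SimpleGraph V}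
    (hG : G.Connected) {s : Finset V} (hs : IsIndepSet G s) (hcard : 1 < s.card) :
    IsIndepBroadcast G ((s : Set V).indicator 1) := by
  constructor
  · intro x
    by_cases hx : x ∈ s
    · obtain ⟨y, -, hyx⟩ := Finset.exists_mem_ne hcard x
      have h := hG.pos_dist_of_ne hyx.symm
      simpa [hx] using Nat.succ_le_of_lt (h.trans_le (dist_le_ecc G x y))
    · simp [hx]
  · intro x y hxy hfx hfy
    have hx : x ∈ s := by simpa using Set.mem_of_indicator_ne_zero hfx.ne'
    have hy : y ∈ s := by simpa using Set.mem_of_indicator_ne_zero hfy.ne'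
    have hpos := hG.pos_dist_of_ne hxy
    have hne : G.dist x y ≠ 1 := fun h => hs x hx y hy hxy (SimpleGraph.dist_eq_one_iff_adj.mp h)
    simp only [Set.indicator_of_mem (Finset.mem_coe.mpr hx),
      Set.indicator_of_mem (Finset.mem_coe.mpr hy), Pi.one_apply, max_self]
    omega

/-- In a graph of diameter at most two, the weight of an independent broadcast is at most
`max 2 (indepNum G)`. -/
lemma IsIndepBroadcast.sum_le {V : Type*} [Fintype V] {G : SimpleGraph V} {f : V → ℕ}
    (hf : IsIndepBroadcast G f) (hdist : ∀ x y, G.dist x y ≤ 2) :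
    ∑ x, f x ≤ max 2 (indepNum G) := by
  by_cases h : ∃ x, 2 ≤ f x
  · obtain ⟨x, hx⟩ := h
    have hzero : ∀ y, y ≠ x → f y = 0 := by
      intro y hy
      by_contra hy0
      have := hf.2 x y hy.symm (by omega) (by omega)
      have := hdist x y
      omega
    have : Nonempty V := ⟨x⟩
    rw [Fintype.sum_eq_single x hzero]
    exact ((hf.1 x).trans (ciSup_le (hdist x))).trans (le_max_left _ _)
  · push Not at h
    have hind : IsIndepSet G {x | 0 < f x} := by
      intro x hx y hy hxy hadj
      simp only [Finset.mem_filter, Finset.mem_univ, true_and] at hx hy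
      have := hf.2 x y hxy hx hy
      rw [SimpleGraph.dist_eq_one_iff_adj.mpr hadj] at this
      omega
    refine le_trans ?_ (hind.card_le_indepNum.trans (le_max_right _ _))
    rw [Finset.card_filter]
    refine Finset.sum_le_sum fun x _ => ?_
    have := h x
    split_ifs <;> omega

/-- If `G` is a finite connected graph with diameter two and `α(G) ≥ 3`,
then `α_b(G) = α(G)`. -/
theorem stmt5 {V : Type*} [Fintype V] (G : SimpleGraph V) (hG : G.Connected)
    (hdiam : G.diam = 2) (halpha : 3 ≤ indepNum G) :
    broadcastIndepNum G = indepNum G := by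
  have hdist : ∀ x y, G.dist x y ≤ 2 := fun x y => hdiam ▸
    SimpleGraph.dist_le_diam (SimpleGraph.ediam_ne_top_of_diam_ne_zero (by omega))
  have hub : ∀ w ∈ {w | ∃ f : V → ℕ, IsIndepBroadcast G f ∧ w = ∑ x, f x}, w ≤ indepNum G := by
    rintro w ⟨f, hf, rfl⟩
    have := hf.sum_le hdist
    omega
  obtain ⟨s, hs, hcard⟩ := exists_isIndepSet_card_eq_indepNum G
  refine IsGreatest.csSup_eq ⟨⟨_, hs.isIndepBroadcast_indicator hG (by omega), ?_⟩, hub⟩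
  classical
  simp [← hcard, Set.indicator_apply]
end

section
/- Let T be a finite tree of order n, let u be a vertex of T, and let p_in, q_in, p_out, q_out be integers with −n ≤ p_in, p_out ≤ n and 1 ≤ q_in, q_out ≤ n. Consider the set S of nonnegative integers m such that: m ≤ ecc_T(u), m ≤ g_{(p_in,q_in)}(0), and if m > 0 then g_{(p_out,q_out)}(d) ≤ g_{(m,m)}(d) for every positive integer d. Then the maximum element of S equals 0 if q_out > p_out, and equals min{ ecc_T(u), g_{(p_in,q_in)}(0), p_out } if q_out ≤ p_out. -/
theorem gfun_zero_nonneg {p q : ℤ} (hq : 1 ≤ q) : 0 ≤ gfun p q 0 := by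
  unfold gfun
  split_ifs <;> omega

/-- For positive `m`, the function `gfun m m` dominates `gfun p q` on the positive integers
exactly when `q ≤ p` and `m ≤ p`. -/
theorem gfun_le_gfun_self_iff {p q m : ℤ} (hq : 1 ≤ q) (hm : 0 < m) :
    (∀ d : ℤ, 0 < d → gfun p q d ≤ gfun m m d) ↔ q ≤ p ∧ m ≤ p := by
  unfold gfun
  constructor
  · intro h
    have hqp : q ≤ p := by
      have := h (max p m + 1) (by omega)
      split_ifs at this <;> omega
    refine ⟨hqp, ?_⟩
    have := h (p + 1) (by omega)
    split_ifs at this <;> omega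
  · rintro ⟨hqp, hmp⟩ d hd
    split_ifs <;> omega

/-- Lemma 4 (base case of the dynamic program): for a single vertex `u` of a tree `T` of
order `n`, the maximum `m` with `m ≤ ecc_T(u)`, `m ≤ g_{(p_in,q_in)}(0)`, and
(`m > 0` implies `g_{(p_out,q_out)}(d) ≤ g_{(m,m)}(d)` for every positive integer `d`)
equals `0` if `q_out > p_out`, and `min {ecc_T(u), g_{(p_in,q_in)}(0), p_out}` otherwise. -/
theorem stmt10 {V : Type*} [Fintype V] (T : SimpleGraph V) (hT : T.IsTree)
    (n : ℕ) (hn : n = Fintype.card V) (u : V) (pin qin pout qout : ℤ)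
    (hpin : -(n : ℤ) ≤ pin ∧ pin ≤ n) (hpout : -(n : ℤ) ≤ pout ∧ pout ≤ n)
    (hqin : 1 ≤ qin ∧ qin ≤ n) (hqout : 1 ≤ qout ∧ qout ≤ n) :
    ((sSup {m : ℕ | (m : ℤ) ≤ (ecc T u : ℤ) ∧ (m : ℤ) ≤ gfun pin qin 0 ∧
        (0 < m → ∀ d : ℤ, 0 < d → gfun pout qout d ≤ gfun (m : ℤ) (m : ℤ) d)} : ℕ) : ℤ) =
      if pout < qout then 0
      else min (min (ecc T u : ℤ) (gfun pin qin 0)) pout := by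
  have hin := gfun_zero_nonneg (p := pin) hqin.1
  have key : ∀ m : ℕ, (0 < m → ∀ d : ℤ, 0 < d → gfun pout qout d ≤ gfun (m : ℤ) (m : ℤ) d) ↔
      (0 < m → qout ≤ pout ∧ (m : ℤ) ≤ pout) := fun m =>
    forall_congr' fun hm => gfun_le_gfun_self_iff hqout.1 (by exact_mod_cast hm)
  simp only [key]
  generalize ecc T u = e
  generalize gfun pin qin 0 = a at hin ⊢
  obtain ⟨M, hM⟩ : ∃ M : ℕ, (M : ℤ) = if pout < qout then 0 else min (min (e : ℤ) a) pout :=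
    Int.eq_ofNat_of_zero_le (by split_ifs <;> omega) |>.imp fun _ h => h.symm
  rw [← hM, Nat.cast_inj]
  refine IsGreatest.csSup_eq ⟨⟨?_, ?_, fun _ => ⟨?_, ?_⟩⟩, ?_⟩
  any_goals split_ifs at hM <;> omega
  rintro m ⟨he, ha, hm⟩
  split_ifs at hM <;> omega
end

section
/- Let T be a finite tree of order n rooted at a vertex r, let u be a vertex of T with children v_1,...,v_k (in a fixed linear order), let i ∈ {1,...,k}, and let v_i have k_i children. Let p_in, q_in, p_out, q_out be integers with −n ≤ p_in, p_out ≤ n and 1 ≤ q_in, q_out ≤ n, and let f : V(u,i) → ℕ. If there exist integers p_in^0, p_out^0, p_in^1, p_out^1 in [−n, n] and q_in^0, q_out^0, q_in^1, q_out^1 in [1, n] such that: (i) the restriction of f to V(u,i−1) is ((p_in^0,q_in^0),(p_out^0,q_out^0))-compatible (with respect to u); (ii) the restriction of f to V(v_i,k_i) is ((p_in^1,q_in^1),(p_out^1,q_out^1))-compatible (with respect to v_i); (iii) g_{(p_in^0,q_in^0)}(d) = min{ g_{(p_in,q_in)}(d), g_{(p_out^1,q_out^1)}(d+1) } for every nonnegative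 integer d; (iv) g_{(p_in^1,q_in^1)}(d) = min{ g_{(p_in,q_in)}(d+1), g_{(p_out^0,q_out^0)}(d+1) } for every nonnegative integer d; and (v) g_{(p_out,q_out)}(d) ≤ min{ g_{(p_out^0,q_out^0)}(d), g_{(p_out^1,q_out^1)}(d+1) } for every positive integer d; then f is ((p_in,q_in),(p_out,q_out))-compatible (with respect to u). -/
/-- In the tree `T` rooted at `r`, the vertex `y` is a descendant of `v`, that is,
`v` lies on the path from `r` to `y`. -/
def IsDesc {V : Type*} (T : SimpleGraph V) (r v y : V) : Prop :=
  T.dist r y = T.dist r v + T.dist v y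

/-- The vertex set `V(u,i)` of the subtree `T(u,i)` of the tree `T` rooted at `r`:
it consists of `u` together with all descendants of the first `i` children
`c 0, ..., c (i-1)` of `u` (in the fixed linear order `c` on the children of `u`). -/
def subtreeSet {V : Type*} (T : SimpleGraph V) (r u : V) {k : ℕ} (c : Fin k → V)
    (i : ℕ) : Set V :=
  {u} ∪ {y | ∃ j : Fin k, (j : ℕ) < i ∧ IsDesc T r (c j) y}

/-- A function `f` on the vertex set `S = V(u0,i)` is
`((p_in,q_in),(p_out,q_out))`-compatible (with respect to `u0`) if
(C1) `f x ≤ ecc_T(x)` on `S`;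
(C2) `dist_T(x,y) > max {f x, f y}` for distinct `x, y ∈ S` with positive values;
(C3) `f x ≤ g_{(p_in,q_in)}(dist_T(u0,x))` on `S`; and
(C4) every `x ∈ S` with `f x > 0` satisfies
     `g_{(p_out,q_out)}(d) ≤ g_{(f x,f x)}(d + dist_T(u0,x))` for every `d > 0`. -/
def Compatible {V : Type*} (T : SimpleGraph V) (u0 : V) (S : Set V)
    (pin qin pout qout : ℤ) (f : V → ℕ) : Prop :=
  (∀ x ∈ S, f x ≤ ecc T x) ∧
  (∀ x ∈ S, ∀ y ∈ S, x ≠ y → 0 < f x → 0 < f y → max (f x) (f y) < T.dist x y) ∧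
  (∀ x ∈ S, (f x : ℤ) ≤ gfun pin qin (T.dist u0 x)) ∧
  (∀ x ∈ S, 0 < f x → ∀ d : ℤ, 0 < d →
    gfun pout qout d ≤ gfun (f x) (f x) (d + T.dist u0 x))

namespace SimpleGraph

variable {V : Type*} {G : SimpleGraph V}

lemma IsTree.length_eq_dist_of_isPath (hG : G.IsTree) {x y : V} {p : G.Walk x y}
    (hp : p.IsPath) : p.length = G.dist x y := by
  obtain ⟨q, hq, hlen⟩ := hG.connected.exists_path_of_dist x y
  rw [(hG.existsUnique_path x y).unique hp hq, hlen]

/-- In a tree, geodesics leaving `u` through distinct neighbours concatenate to a geodesic. -/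
lemma IsTree.dist_eq_dist_add_dist (hG : G.IsTree) {u a b x y : V} (hua : G.Adj u a)
    (hub : G.Adj u b) (hab : a ≠ b) (hx : G.dist u x = G.dist a x + 1)
    (hy : G.dist u y = G.dist b y + 1) : G.dist x y = G.dist u x + G.dist u y := by
  obtain ⟨pa, hpa⟩ := hG.connected.exists_walk_length_eq_dist a x
  obtain ⟨pb, hpb⟩ := hG.connected.exists_walk_length_eq_dist b y
  have hlx : (Walk.cons hua pa).length = G.dist u x := by simp [hpa, hx]
  have hly : (Walk.cons hub pb).length = G.dist u y := by simp [hpb, hy]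
  have hcx := (hG.isAcyclic.isPath_iff_isChain _).1
    ((Walk.cons hua pa).isPath_of_length_eq_dist hlx).reverse
  have hcy := (hG.isAcyclic.isPath_iff_isChain _).1
    ((Walk.cons hub pb).isPath_of_length_eq_dist hly)
  have hpath : ((Walk.cons hua pa).reverse.append (Walk.cons hub pb)).IsPath := by
    rw [hG.isAcyclic.isPath_iff_isChain, Walk.edges_append, List.isChain_append]
    refine ⟨hcx, hcy, ?_⟩
    simpa using ⟨fun h => absurd h hua.ne', hab⟩
  rw [← hG.length_eq_dist_of_isPath hpath, Walk.length_append, Walk.length_reverse, hlx, hly]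

/-- A vertex `y ≠ v` is reached from `v` through a neighbour that is one step closer to `y`. -/
lemma Connected.exists_adj_dist_eq_add_one (hG : G.Connected) {v y : V} (hne : v ≠ y) :
    ∃ w, G.Adj v w ∧ G.dist v y = G.dist w y + 1 := by
  obtain ⟨p, hp⟩ := hG.exists_walk_length_eq_dist v y
  cases p with
  | nil => exact absurd rfl hne
  | cons h q =>
    rename_i w
    refine ⟨w, h, le_antisymm ?_ ?_⟩
    · have := hG.dist_triangle (u := v) (v := w) (w := y)
      rw [dist_eq_one_iff_adj.2 h] at this
      omega
    · have := dist_le q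
      rw [Walk.length_cons] at hp
      omega

end SimpleGraph

section Descendants

variable {V : Type*} {T : SimpleGraph V} {r u v y : V}

lemma IsDesc.dist_parent (hT : T.Connected) (huv : T.Adj u v)
    (hr : T.dist r v = T.dist r u + 1) (h : IsDesc T r v y) :
    T.dist u y = T.dist v y + 1 := by
  have h₁ := hT.dist_triangle (u := u) (v := v) (w := y)
  have h₂ := hT.dist_triangle (u := r) (v := u) (w := y)
  rw [SimpleGraph.dist_eq_one_iff_adj.2 huv] at h₁
  unfold IsDesc at h
  omega

/-- The subtree spanned by a vertex and all of its children contains all descendants. -/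
lemma IsDesc.mem_subtreeSet (hT : T.Connected) {k : ℕ} {c : Fin k → V}
    (hc : ∀ w, T.Adj v w → T.dist r w = T.dist r v + 1 → ∃ j, c j = w)
    (h : IsDesc T r v y) : y ∈ subtreeSet T r v c k := by
  by_cases hne : v = y
  · exact Or.inl hne.symm
  obtain ⟨w, hvw, hw⟩ := hT.exists_adj_dist_eq_add_one hne
  have h₁ := hT.dist_triangle (u := r) (v := w) (w := y)
  have h₂ := hT.dist_triangle (u := r) (v := v) (w := w)
  rw [SimpleGraph.dist_eq_one_iff_adj.2 hvw] at h₂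
  unfold IsDesc at h
  obtain ⟨j, rfl⟩ := hc w hvw (by omega)
  refine Or.inr ⟨j, j.2, ?_⟩
  unfold IsDesc
  omega

end Descendants

lemma lt_of_le_gfun_self {a b : ℕ} {d : ℤ} (hb : 0 < b) (h : (b : ℤ) ≤ gfun a a d) :
    (a : ℤ) < d ∧ (b : ℤ) < d := by
  unfold gfun at h
  split_ifs at h <;> omega


/-- Lemma 5, second direction: if there exist integers
`p_in^0, p_out^0, p_in^1, p_out^1 ∈ [-n,n]` and `q_in^0, q_out^0, q_in^1, q_out^1 ∈ [1,n]`
satisfying conditions (i)–(v) for `f : V(u,i) → ℕ`, then `f` is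
`((p_in,q_in),(p_out,q_out))`-compatible (with respect to `u`). -/
theorem stmt12 {V : Type*} [Fintype V] (T : SimpleGraph V) (hT : T.IsTree)
    (n : ℕ) (hn : n = Fintype.card V) (r : V)
    -- u is a vertex with children c 0, ..., c (k-1) in a fixed linear order
    (u : V) (k : ℕ) (c : Fin k → V) (hcinj : Function.Injective c)
    (hchild : ∀ j, T.Adj u (c j) ∧ T.dist r (c j) = T.dist r u + 1)
    (hallchild : ∀ v, T.Adj u v → T.dist r v = T.dist r u + 1 → ∃ j, c j = v)
    (i : ℕ) (hi1 : 1 ≤ i) (hik : i ≤ k)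
    -- vi is the i-th child of u, with children ci 0, ..., ci (ki-1)
    (vi : V) (hvi : vi = c ⟨i - 1, by omega⟩)
    (ki : ℕ) (ci : Fin ki → V) (hciinj : Function.Injective ci)
    (hcichild : ∀ j, T.Adj vi (ci j) ∧ T.dist r (ci j) = T.dist r vi + 1)
    (hciall : ∀ v, T.Adj vi v → T.dist r v = T.dist r vi + 1 → ∃ j, ci j = v)
    (pin qin pout qout : ℤ)
    (hpin : -(n : ℤ) ≤ pin ∧ pin ≤ n) (hpout : -(n : ℤ) ≤ pout ∧ pout ≤ n)
    (hqin : 1 ≤ qin ∧ qin ≤ n) (hqout : 1 ≤ qout ∧ qout ≤ n)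
    (f : V → ℕ)
    (pin0 pout0 pin1 pout1 qin0 qout0 qin1 qout1 : ℤ)
    (hpin0 : -(n : ℤ) ≤ pin0 ∧ pin0 ≤ n) (hpout0 : -(n : ℤ) ≤ pout0 ∧ pout0 ≤ n)
    (hpin1 : -(n : ℤ) ≤ pin1 ∧ pin1 ≤ n) (hpout1 : -(n : ℤ) ≤ pout1 ∧ pout1 ≤ n)
    (hqin0 : 1 ≤ qin0 ∧ qin0 ≤ n) (hqout0 : 1 ≤ qout0 ∧ qout0 ≤ n)
    (hqin1 : 1 ≤ qin1 ∧ qin1 ≤ n) (hqout1 : 1 ≤ qout1 ∧ qout1 ≤ n)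
    -- (i) the restriction of f to V(u,i-1) is compatible (with respect to u)
    (hc0 : Compatible T u (subtreeSet T r u c (i - 1)) pin0 qin0 pout0 qout0 f)
    -- (ii) the restriction of f to V(v_i,k_i) is compatible (with respect to v_i)
    (hc1 : Compatible T vi (subtreeSet T r vi ci ki) pin1 qin1 pout1 qout1 f)
    -- (iii)
    (hiii : ∀ d : ℤ, 0 ≤ d →
      gfun pin0 qin0 d = min (gfun pin qin d) (gfun pout1 qout1 (d + 1)))
    -- (iv)
    (hiv : ∀ d : ℤ, 0 ≤ d →
      gfun pin1 qin1 d = min (gfun pin qin (d + 1)) (gfun pout0 qout0 (d + 1)))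
    -- (v)
    (hv : ∀ d : ℤ, 0 < d →
      gfun pout qout d ≤ min (gfun pout0 qout0 d) (gfun pout1 qout1 (d + 1))) :
    Compatible T u (subtreeSet T r u c i) pin qin pout qout f := by
  have hconn := hT.connected
  set m : Fin k := ⟨i - 1, by omega⟩ with hm
  have huvi : T.Adj u vi := hvi ▸ (hchild m).1
  have hrvi : T.dist r vi = T.dist r u + 1 := hvi ▸ (hchild m).2
  have hsplit : ∀ x ∈ subtreeSet T r u c i,
      x ∈ subtreeSet T r u c (i - 1) ∨ IsDesc T r vi x := by
    rintro x (hx | ⟨j, hj, hx⟩)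
    · exact Or.inl (Or.inl hx)
    · by_cases hlt : (j : ℕ) < i - 1
      · exact Or.inl (Or.inr ⟨j, hlt, hx⟩)
      · have hjm : j = m := Fin.ext (by rw [hm]; simp only; omega)
        exact Or.inr (by rwa [hvi, ← hjm])
  have hmem : ∀ {y}, IsDesc T r vi y → y ∈ subtreeSet T r vi ci ki :=
    fun h => h.mem_subtreeSet hconn hciall
  have hdist : ∀ {y}, IsDesc T r vi y → T.dist u y = T.dist vi y + 1 :=
    fun h => h.dist_parent hconn huvi hrvi
  have hcross : ∀ x ∈ subtreeSet T r u c (i - 1), ∀ y, IsDesc T r vi y →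
      T.dist x y = T.dist u x + T.dist u y := by
    rintro x (rfl | ⟨j, hj, hx⟩) y hy
    · simp
    · refine hT.dist_eq_dist_add_dist (hchild j).1 huvi ?_
        (hx.dist_parent hconn (hchild j).1 (hchild j).2) (hdist hy)
      rw [hvi]
      intro h
      have := congrArg Fin.val (hcinj h)
      rw [hm] at this
      simp only at this
      omega
  obtain ⟨ecc₀, sep₀, in₀, out₀⟩ := hc0
  obtain ⟨ecc₁, sep₁, in₁, out₁⟩ := hc1
  have hsep : ∀ x ∈ subtreeSet T r u c (i - 1), ∀ y, IsDesc T r vi y →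
      0 < f x → 0 < f y → max (f x) (f y) < T.dist x y := by
    intro x hx y hy hfx hfy
    have h₁ := in₁ y (hmem hy)
    rw [hiv _ (by positivity)] at h₁
    have h₂ := out₀ x hx hfx (T.dist vi y + 1) (by positivity)
    have h₃ := lt_of_le_gfun_self hfy ((h₁.trans (min_le_right _ _)).trans h₂)
    have h₄ := hcross x hx y hy
    have h₅ := hdist hy
    omega
  refine ⟨fun x hx => ?_, fun x hx y hy hne hfx hfy => ?_, fun x hx => ?_,
    fun x hx hfx d hd => ?_⟩
  · rcases hsplit x hx with hx | hx
    · exact ecc₀ x hx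
    · exact ecc₁ x (hmem hx)
  · rcases hsplit x hx with hx | hx <;> rcases hsplit y hy with hy | hy
    · exact sep₀ x hx y hy hne hfx hfy
    · exact hsep x hx y hy hfx hfy
    · rw [max_comm, SimpleGraph.dist_comm]
      exact hsep y hy x hx hfy hfx
    · exact sep₁ x (hmem hx) y (hmem hy) hne hfx hfy
  · rcases hsplit x hx with hx | hx
    · have h := in₀ x hx
      rw [hiii _ (by positivity)] at h
      exact h.trans (min_le_left _ _)
    · have h := in₁ x (hmem hx)
      rw [hiv _ (by positivity)] at h
      rw [hdist hx, Nat.cast_add, Nat.cast_one]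
      exact h.trans (min_le_left _ _)
  · rcases hsplit x hx with hx | hx
    · exact ((hv d hd).trans (min_le_left _ _)).trans (out₀ x hx hfx d hd)
    · have h := out₁ x (hmem hx) hfx (d + 1) (by omega)
      rw [hdist hx, Nat.cast_add, Nat.cast_one, add_comm (T.dist vi x : ℤ), ← add_assoc]
      exact ((hv d hd).trans (min_le_right _ _)).trans h
end

section
/- Let T be a finite tree of order n rooted at a vertex r, let u be a vertex of T with children v_1,...,v_k (in a fixed linear order), let i ∈ {1,...,k}, and let v_i have k_i children. Let p_in, q_in, p_out, q_out be integers with −n ≤ p_in, p_out ≤ n and 1 ≤ q_in, q_out ≤ n. Then β((u,i),(p_in,q_in),(p_out,q_out)) equals the maximum, over all choices of integers p_in^0, p_out^0, p_in^1, p_out^1 in [−n, n] and q_in^0, q_out^0, q_in^1, q_out^1 in [1, n] satisfying (iii) g_{(p_in^0,q_in^0)}(d) = min{ g_{(p_in,q_in)}(d), g_{(p_out^1,q_out^1)}(d+1) } for every nonnegative integer d, (iv) g_{(p_in^1,q_in^1)}(d) = min{ g_{(p_in,q_in)}(d+1), g_{(p_out^0,q_out^0)}(d+1) } for every nonnegative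 integer d, and (v) g_{(p_out,q_out)}(d) ≤ min{ g_{(p_out^0,q_out^0)}(d), g_{(p_out^1,q_out^1)}(d+1) } for every positive integer d, of the sum β((u,i−1),(p_in^0,q_in^0),(p_out^0,q_out^0)) + β((v_i,k_i),(p_in^1,q_in^1),(p_out^1,q_out^1)). -/
/-- `β((u0,S),(p_in,q_in),(p_out,q_out))`: the maximum weight `∑_{x ∈ S} f x` of a
`((p_in,q_in),(p_out,q_out))`-compatible function `f` on `S` (extended by zero outside
of `S`). -/
noncomputable def beta {V : Type*} [Fintype V] (T : SimpleGraph V) (u0 : V) (S : Set V)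
    (pin qin pout qout : ℤ) : ℕ :=
  sSup {w | ∃ f : V → ℕ, (∀ x, x ∉ S → f x = 0) ∧
    Compatible T u0 S pin qin pout qout f ∧ w = ∑ x, f x}

open SimpleGraph

/-! ### Distances in trees -/

/-- If the edge `ab` of a tree separates `x` from `y`, then the distance between `x` and `y` is
obtained by passing through `ab`. -/
lemma SimpleGraph.IsTree.dist_eq_of_adj {V : Type*} {T : SimpleGraph V} (hT : T.IsTree)
    {a b x y : V} (hab : T.Adj a b) (hx : T.dist x b = T.dist x a + 1)
    (hy : T.dist y a = T.dist y b + 1) :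
    T.dist x y = T.dist a x + 1 + T.dist b y := by
  classical
  have htri := fun {p q s : V} => hT.connected.dist_triangle (u := p) (v := q) (w := s)
  have hcomm := fun p q : V => dist_comm (G := T) (u := p) (v := q)
  obtain ⟨p, hp, hpl⟩ := hT.connected.exists_path_of_dist x a
  obtain ⟨q, hq, hql⟩ := hT.connected.exists_path_of_dist b y
  obtain ⟨s, hs, hsl⟩ := hT.connected.exists_path_of_dist x y
  have hpath : (p.append (Walk.cons hab q)).IsPath := by
    rw [Walk.isPath_def, Walk.support_append, Walk.support_cons, List.tail_cons, List.nodup_append]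
    refine ⟨hp.support_nodup, hq.support_nodup, ?_⟩
    rintro z hzp _ hzq rfl
    have h1 := T.dist_le (p.takeUntil z hzp)
    have h2 := T.dist_le (p.dropUntil z hzp)
    have h3 := congrArg Walk.length (p.take_spec hzp)
    have h4 := T.dist_le (q.takeUntil z hzq)
    have h5 := T.dist_le (q.dropUntil z hzq)
    have h6 := congrArg Walk.length (q.take_spec hzq)
    rw [Walk.length_append] at h3 h6
    have h7 : T.dist x b ≤ T.dist x z + T.dist z b := htri
    have h8 : T.dist y a ≤ T.dist y z + T.dist z a := htri
    have h9 := hcomm z b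
    have h10 := hcomm z y
    have h11 := hcomm b y
    omega
  have heq := (hT.isAcyclic.subsingleton_path x y).elim ⟨s, hs⟩ ⟨_, hpath⟩
  have hlen : s.length = (p.append (Walk.cons hab q)).length :=
    congrArg (fun w : T.Path x y => w.1.length) heq
  rw [Walk.length_append, Walk.length_cons] at hlen
  have := hcomm a x
  omega

lemma SimpleGraph.Connected.dist_lt_card {V : Type*} [Fintype V] {G : SimpleGraph V}
    (hG : G.Connected) (x y : V) : G.dist x y < Fintype.card V := by
  obtain ⟨p, hp, hpl⟩ := hG.exists_path_of_dist x y
  exact hpl ▸ hp.length_lt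

lemma SimpleGraph.Connected.ecc_lt_card {V : Type*} [Fintype V] {G : SimpleGraph V}
    (hG : G.Connected) (x : V) : ecc G x < Fintype.card V := by
  have : Nonempty V := ⟨x⟩
  obtain ⟨y, hy⟩ := Nat.sSup_mem (Set.range_nonempty (fun y => G.dist x y))
    (Set.finite_range _).bddAbove
  rw [ecc, iSup, ← hy]
  exact hG.dist_lt_card x y

lemma isDesc_iff_of_adj {V : Type*} {T : SimpleGraph V} (hT : T.IsTree) {r u v y : V}
    (huv : T.Adj u v) (hr : T.dist r v = T.dist r u + 1) :
    IsDesc T r v y ↔ T.dist y u = T.dist y v + 1 := by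
  have htri : T.dist r y ≤ T.dist r u + T.dist u y := hT.connected.dist_triangle
  have h1 := dist_comm (G := T) (u := u) (v := y)
  have h2 := dist_comm (G := T) (u := v) (v := y)
  have h3 := dist_comm (G := T) (u := u) (v := r)
  refine ⟨fun h => ?_, fun h => ?_⟩
  · rw [IsDesc] at h
    have := hT.dist_eq_dist_add_one_of_adj y huv
    omega
  · rw [IsDesc, hT.dist_eq_of_adj huv hr h]
    omega

lemma not_isDesc_of_isDesc {V : Type*} {T : SimpleGraph V} (hT : T.IsTree) {r u v w y : V}
    (huv : T.Adj u v) (hrv : T.dist r v = T.dist r u + 1)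
    (huw : T.Adj u w) (hrw : T.dist r w = T.dist r u + 1) (hvw : v ≠ w)
    (hy : IsDesc T r v y) : ¬ IsDesc T r w y := by
  intro hy'
  rw [isDesc_iff_of_adj hT huv hrv] at hy
  rw [isDesc_iff_of_adj hT huw hrw] at hy'
  have h1 := dist_eq_one_iff_adj.mpr huv
  have h2 := hT.connected.pos_dist_of_ne hvw
  have h3 := dist_comm (G := T) (u := u) (v := v)
  have h4 := dist_comm (G := T) (u := w) (v := y)
  have h5 := dist_comm (G := T) (u := v) (v := y)
  have h6 := hT.dist_eq_dist_add_one_of_adj v huw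
  have h7 := hT.dist_eq_of_adj huw (x := v) (y := y) (by omega) hy'
  omega

/-- The subtree spanned by a vertex and all its children's subtrees is its set of descendants. -/
lemma mem_subtreeSet_iff_isDesc {V : Type*} {T : SimpleGraph V} (hT : T.IsTree) {r v : V}
    {k : ℕ} {c : Fin k → V} (hchild : ∀ j, T.Adj v (c j) ∧ T.dist r (c j) = T.dist r v + 1)
    (hall : ∀ w, T.Adj v w → T.dist r w = T.dist r v + 1 → ∃ j, c j = w) (y : V) :
    y ∈ subtreeSet T r v c k ↔ IsDesc T r v y := by
  have htri := fun {p q s : V} => hT.connected.dist_triangle (u := p) (v := q) (w := s)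
  constructor
  · rintro (rfl | ⟨j, -, hj⟩)
    · simp [IsDesc]
    · rw [IsDesc] at hj ⊢
      have h1 := dist_eq_one_iff_adj.mpr (hchild j).1
      have h2 := (hchild j).2
      have h3 : T.dist v y ≤ T.dist v (c j) + T.dist (c j) y := htri
      have h4 : T.dist r y ≤ T.dist r v + T.dist v y := htri
      omega
  · intro hy
    rcases eq_or_ne y v with rfl | hne
    · exact Or.inl rfl
    · obtain ⟨p, hp⟩ := hT.connected.exists_walk_length_eq_dist v y
      cases p with
      | nil => exact absurd rfl hne
      | @cons _ w _ h p =>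
        rw [IsDesc] at hy
        rw [Walk.length_cons] at hp
        have h1 := T.dist_le p
        have h2 : T.dist r y ≤ T.dist r w + T.dist w y := htri
        have h3 : T.dist r w ≤ T.dist r v + T.dist v w := htri
        have h4 := dist_eq_one_iff_adj.mpr h
        obtain ⟨j, rfl⟩ := hall w h (by omega)
        refine Or.inr ⟨j, j.2, ?_⟩
        rw [IsDesc]
        omega

/-! ### Compatible functions and their maximum weight -/

lemma gfun_nonneg {p q : ℤ} (hq : 0 ≤ q) (d : ℤ) : 0 ≤ gfun p q d := by
  unfold gfun
  split_ifs <;> omega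

lemma compatible_zero {V : Type*} (T : SimpleGraph V) (u : V) (S : Set V)
    (pin pout qout : ℤ) {qin : ℤ} (hq : 1 ≤ qin) :
    Compatible T u S pin qin pout qout fun _ => 0 :=
  ⟨fun _ _ => Nat.zero_le _, fun _ _ _ _ _ h => absurd h (lt_irrefl 0),
    fun _ _ => by simpa using gfun_nonneg (by omega) _, fun _ _ h => absurd h (lt_irrefl 0)⟩

lemma bddAbove_weights {V : Type*} [Fintype V] (T : SimpleGraph V) (u : V) (S : Set V)
    (pin qin pout qout : ℤ) :
    BddAbove {w | ∃ f : V → ℕ, (∀ x, x ∉ S → f x = 0) ∧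
      Compatible T u S pin qin pout qout f ∧ w = ∑ x, f x} := by
  refine ⟨∑ x, ecc T x, ?_⟩
  rintro _ ⟨f, hf0, hf, rfl⟩
  refine Finset.sum_le_sum fun x _ => ?_
  by_cases hx : x ∈ S
  · exact hf.1 x hx
  · simp [hf0 x hx]

lemma sum_le_beta {V : Type*} [Fintype V] {T : SimpleGraph V} {u : V} {S : Set V}
    {pin qin pout qout : ℤ} {f : V → ℕ} (hf0 : ∀ x, x ∉ S → f x = 0)
    (hf : Compatible T u S pin qin pout qout f) :
    ∑ x, f x ≤ beta T u S pin qin pout qout :=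
  le_csSup (bddAbove_weights T u S pin qin pout qout) ⟨f, hf0, hf, rfl⟩

lemma exists_compatible_sum_eq_beta {V : Type*} [Fintype V] (T : SimpleGraph V) (u : V)
    (S : Set V) (pin pout qout : ℤ) {qin : ℤ} (hq : 1 ≤ qin) :
    ∃ f : V → ℕ, (∀ x, x ∉ S → f x = 0) ∧ Compatible T u S pin qin pout qout f ∧
      beta T u S pin qin pout qout = ∑ x, f x :=
  Nat.sSup_mem (s := {w | ∃ f : V → ℕ, (∀ x, x ∉ S → f x = 0) ∧
      Compatible T u S pin qin pout qout f ∧ w = ∑ x, f x})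
    ⟨_, _, fun _ _ => rfl, compatible_zero T u S pin pout qout hq, rfl⟩
    (bddAbove_weights T u S pin qin pout qout)

/-- The optimal outgoing parameters of `f` on `S`: each value of the resulting function `g` is
either large or attained by some vertex of `S` with a positive value. -/
lemma exists_outgoing_parameters {V : Type*} [Fintype V] {T : SimpleGraph V} (u : V) (S : Set V)
    (f : V → ℕ) {n : ℕ} (hdist : ∀ x, T.dist u x < n) (hf : ∀ x ∈ S, f x < n) :
    ∃ p q : ℤ, -(n : ℤ) + 1 ≤ p ∧ p ≤ n ∧ 1 ≤ q ∧ q ≤ n ∧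
      (∀ x ∈ S, 0 < f x → ∀ d : ℤ, 0 < d → gfun p q d ≤ gfun (f x) (f x) (d + T.dist u x)) ∧
      ∀ d : ℤ, 0 < d → gfun p q d = d + n - 1 ∨
        ∃ x ∈ S, 0 < f x ∧ gfun p q d = gfun (f x) (f x) (d + T.dist u x) := by
  classical
  have hn := hdist u
  let A : Finset V := Finset.univ.filter fun x => x ∈ S ∧ 0 < f x
  have hA : ∀ x, x ∈ A ↔ x ∈ S ∧ 0 < f x := by simp [A]
  rcases A.eq_empty_or_nonempty with hAe | hAne
  · refine ⟨0, n, by omega, by omega, by omega, le_rfl, fun x hx hfx => ?_, fun d hd => Or.inl ?_⟩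
    · have := (hA x).2 ⟨hx, hfx⟩
      simp [hAe] at this
    · rw [gfun, if_neg (by omega)]
      omega
  · obtain ⟨a, haA, ha⟩ := A.exists_max_image (fun x => (f x : ℤ) - T.dist u x) hAne
    obtain ⟨b, hbA, hb⟩ := A.exists_min_image (fun x => T.dist u x) hAne
    have ha' := (hA a).1 haA
    have hb' := (hA b).1 hbA
    have h1 := ha b hbA
    have h2 := hb a haA
    have h3 := hdist a
    have h4 := hf a ha'.1
    refine ⟨(f a : ℤ) - T.dist u a, (f a : ℤ) - T.dist u a + T.dist u b, by omega, by omega,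
      by omega, by omega, fun x hx hfx d hd => ?_, fun d hd => Or.inr ?_⟩
    · have h5 := ha x ((hA x).2 ⟨hx, hfx⟩)
      have h6 := hb x ((hA x).2 ⟨hx, hfx⟩)
      unfold gfun
      split_ifs <;> omega
    · by_cases hda : d ≤ (f a : ℤ) - T.dist u a
      · refine ⟨a, ha'.1, ha'.2, ?_⟩
        rw [gfun, gfun, if_pos hda, if_pos (by omega)]
      · refine ⟨b, hb'.1, hb'.2, ?_⟩
        rw [gfun, gfun, if_neg hda, if_neg (by omega)]
        omega

/-- The minimum of two functions `g` is again such a function. -/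
lemma exists_gfun_eq_min {p q p' q' n : ℤ} (hp : -n ≤ p ∨ -n ≤ p') (hpn : p ≤ n) (hpn' : p' ≤ n)
    (hq : 1 ≤ q) (hqn : q ≤ n) (hq' : 1 ≤ q') (hqn' : q' ≤ n) :
    ∃ P Q : ℤ, -n ≤ P ∧ P ≤ n ∧ 1 ≤ Q ∧ Q ≤ n ∧
      ∀ d, gfun P Q d = min (gfun p q d) (gfun p' q' d) := by
  refine ⟨max p p', max p p' - max (p - q) (p' - q'), by omega, by omega, by omega, by omega,
    fun d => ?_⟩
  unfold gfun
  split_ifs <;> omega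

lemma gfun_succ (p q d : ℤ) : gfun p q (d + 1) = gfun (p - 1) q d := by
  unfold gfun
  split_ifs <;> omega

section Glue

variable {V : Type*} {T : SimpleGraph V} {u v : V} {S S₀ S₁ : Set V}

/-- Compatible functions on the two parts of a subtree glue to a compatible function. -/
lemma Compatible.glue {pin qin pout qout pin0 pout0 pin1 pout1 qin0 qout0 qin1 qout1 : ℤ}
    (hS : ∀ x, x ∈ S ↔ x ∈ S₀ ∨ x ∈ S₁)
    (huv : ∀ y ∈ S₁, T.dist u y = T.dist v y + 1)
    (hcross : ∀ x ∈ S₀, ∀ y ∈ S₁, T.dist x y = T.dist u x + 1 + T.dist v y)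
    (hin0 : ∀ d : ℤ, 0 ≤ d →
      gfun pin0 qin0 d = min (gfun pin qin d) (gfun pout1 qout1 (d + 1)))
    (hin1 : ∀ d : ℤ, 0 ≤ d →
      gfun pin1 qin1 d = min (gfun pin qin (d + 1)) (gfun pout0 qout0 (d + 1)))
    (hout : ∀ d : ℤ, 0 < d →
      gfun pout qout d ≤ min (gfun pout0 qout0 d) (gfun pout1 qout1 (d + 1)))
    {f : V → ℕ} (hf0 : Compatible T u S₀ pin0 qin0 pout0 qout0 f)
    (hf1 : Compatible T v S₁ pin1 qin1 pout1 qout1 f) :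
    Compatible T u S pin qin pout qout f := by
  obtain ⟨a1, a2, a3, a4⟩ := hf0
  obtain ⟨b1, b2, b3, b4⟩ := hf1
  have key : ∀ x ∈ S₀, ∀ y ∈ S₁, 0 < f x → 0 < f y → max (f x) (f y) < T.dist x y := by
    intro x hx y hy hfx hfy
    have h1 := a3 x hx
    rw [hin0 _ (by omega)] at h1
    have h2 := b4 y hy hfy (T.dist u x + 1) (by omega)
    have h3 := hcross x hx y hy
    unfold gfun at h1 h2
    split_ifs at h1 h2 <;> omega
  refine ⟨fun x hx => ?_, fun x hx y hy hxy hfx hfy => ?_, fun x hx => ?_,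
    fun x hx hfx d hd => ?_⟩
  · exact ((hS x).1 hx).elim (a1 x) (b1 x)
  · rcases (hS x).1 hx with hx | hx <;> rcases (hS y).1 hy with hy | hy
    · exact a2 x hx y hy hxy hfx hfy
    · exact key x hx y hy hfx hfy
    · rw [max_comm, dist_comm]
      exact key y hy x hx hfy hfx
    · exact b2 x hx y hy hxy hfx hfy
  · rcases (hS x).1 hx with hx | hx
    · exact (a3 x hx).trans ((hin0 _ (by omega)).trans_le (min_le_left _ _))
    · rw [huv x hx]
      push_cast
      exact (b3 x hx).trans ((hin1 _ (by omega)).trans_le (min_le_left _ _))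
  · rcases (hS x).1 hx with hx | hx
    · exact ((hout d hd).trans (min_le_left _ _)).trans (a4 x hx hfx d hd)
    · have h := ((hout d hd).trans (min_le_right _ _)).trans (b4 x hx hfx (d + 1) (by omega))
      rw [huv x hx]
      push_cast
      rwa [show d + ((T.dist v x : ℤ) + 1) = d + 1 + T.dist v x by ring]

/-- A nonzero compatible function on a subtree splits into compatible functions on its two
parts, for suitable parameters. -/
lemma Compatible.exists_split [Fintype V] {n : ℕ} {pin qin pout qout : ℤ}
    (hS : ∀ x, x ∈ S ↔ x ∈ S₀ ∨ x ∈ S₁)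
    (huv : ∀ y ∈ S₁, T.dist u y = T.dist v y + 1)
    (hcross : ∀ x ∈ S₀, ∀ y ∈ S₁, T.dist x y = T.dist u x + 1 + T.dist v y)
    (hdist : ∀ x y, T.dist x y < n) (hecc : ∀ x, ecc T x < n)
    (hpin : -(n : ℤ) ≤ pin ∧ pin ≤ n) (hqin : 1 ≤ qin ∧ qin ≤ n)
    {f : V → ℕ} (hf : Compatible T u S pin qin pout qout f) (hne : ∃ x ∈ S, 0 < f x) :
    ∃ pin0 pout0 pin1 pout1 qin0 qout0 qin1 qout1 : ℤ,
      (-(n : ℤ) ≤ pin0 ∧ pin0 ≤ n) ∧ (-(n : ℤ) ≤ pout0 ∧ pout0 ≤ n) ∧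
      (-(n : ℤ) ≤ pin1 ∧ pin1 ≤ n) ∧ (-(n : ℤ) ≤ pout1 ∧ pout1 ≤ n) ∧
      (1 ≤ qin0 ∧ qin0 ≤ n) ∧ (1 ≤ qout0 ∧ qout0 ≤ n) ∧
      (1 ≤ qin1 ∧ qin1 ≤ n) ∧ (1 ≤ qout1 ∧ qout1 ≤ n) ∧
      (∀ d : ℤ, 0 ≤ d →
        gfun pin0 qin0 d = min (gfun pin qin d) (gfun pout1 qout1 (d + 1))) ∧
      (∀ d : ℤ, 0 ≤ d →
        gfun pin1 qin1 d = min (gfun pin qin (d + 1)) (gfun pout0 qout0 (d + 1))) ∧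
      (∀ d : ℤ, 0 < d →
        gfun pout qout d ≤ min (gfun pout0 qout0 d) (gfun pout1 qout1 (d + 1))) ∧
      Compatible T u S₀ pin0 qin0 pout0 qout0 f ∧
      Compatible T v S₁ pin1 qin1 pout1 qout1 f := by
  obtain ⟨h1, h2, h3, h4⟩ := hf
  have hS0 : ∀ x ∈ S₀, x ∈ S := fun x hx => (hS x).2 (Or.inl hx)
  have hS1 : ∀ x ∈ S₁, x ∈ S := fun x hx => (hS x).2 (Or.inr hx)
  obtain ⟨pout0, qout0, hp0, hp0', hq0, hq0', hC0, hattain0⟩ := exists_outgoing_parameters u S₀ f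
    (hdist u) (fun x hx => (h1 x (hS0 x hx)).trans_lt (hecc x))
  obtain ⟨pout1, qout1, hp1, hp1', hq1, hq1', hC1, hattain1⟩ := exists_outgoing_parameters v S₁ f
    (hdist v) (fun x hx => (h1 x (hS1 x hx)).trans_lt (hecc x))
  obtain ⟨pin0, qin0, hpi0, hpi0', hqi0, hqi0', hin0⟩ := exists_gfun_eq_min
    (p := pin) (q := qin) (p' := pout1 - 1) (q' := qout1) (n := n)
    (by omega) (by omega) (by omega) (by omega) (by omega) (by omega) (by omega)
  obtain ⟨pin1, qin1, hpi1, hpi1', hqi1, hqi1', hin1⟩ := exists_gfun_eq_min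
    (p := pin - 1) (q := qin) (p' := pout0 - 1) (q' := qout0) (n := n)
    (by omega) (by omega) (by omega) (by omega) (by omega) (by omega) (by omega)
  simp only [← gfun_succ] at hin0 hin1
  have hslack : ∀ d : ℤ, 0 < d → gfun pout qout d ≤ d + n - 1 := by
    intro d hd
    obtain ⟨x, hx, hfx⟩ := hne
    have h := h4 x hx hfx d hd
    have := hdist u x
    unfold gfun at h ⊢
    split_ifs at h ⊢ <;> omega
  have hsep : ∀ x ∈ S, ∀ y ∈ S, 0 < T.dist x y → 0 < f y →
      (f x : ℤ) ≤ gfun (f y) (f y) (T.dist x y) := by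
    intro x hx y hy hxy hfy
    rcases Nat.eq_zero_or_pos (f x) with h0 | hfx
    · rw [h0]
      exact gfun_nonneg (by omega) _
    · have h := h2 x hx y hy (by rintro rfl; simp at hxy) hfx hfy
      rw [gfun, if_neg (by omega)]
      omega
  refine ⟨pin0, pout0, pin1, pout1, qin0, qout0, qin1, qout1, ⟨hpi0, hpi0'⟩, ⟨by omega, hp0'⟩,
    ⟨hpi1, hpi1'⟩, ⟨by omega, hp1'⟩, ⟨hqi0, hqi0'⟩, ⟨hq0, hq0'⟩, ⟨hqi1, hqi1'⟩, ⟨hq1, hq1'⟩,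
    fun d _ => hin0 d, fun d _ => hin1 d, fun d hd => le_min ?_ ?_,
    ⟨fun x hx => h1 x (hS0 x hx), fun x hx y hy => h2 x (hS0 x hx) y (hS0 y hy),
      fun x hx => ?_, hC0⟩,
    ⟨fun x hx => h1 x (hS1 x hx), fun x hx y hy => h2 x (hS1 x hx) y (hS1 y hy),
      fun x hx => ?_, hC1⟩⟩
  · rcases hattain0 d hd with h | ⟨x, hx, hfx, h⟩
    · exact h ▸ hslack d hd
    · exact h ▸ h4 x (hS0 x hx) hfx d hd
  · rcases hattain1 (d + 1) (by omega) with h | ⟨x, hx, hfx, h⟩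
    · have := hslack d hd
      omega
    · have h' := h4 x (hS1 x hx) hfx d hd
      rw [huv x hx] at h'
      push_cast at h'
      rwa [h, add_assoc, add_comm 1]
  · rw [hin0]
    refine le_min (h3 x (hS0 x hx)) ?_
    rcases hattain1 (T.dist u x + 1) (by omega) with h | ⟨y, hy, hfy, h⟩
    · have := h1 x (hS0 x hx)
      have := hecc x
      omega
    · have hd := hcross x hx y hy
      have h' := hsep x (hS0 x hx) y (hS1 y hy) (by omega) hfy
      rw [hd] at h'
      push_cast at h'
      rwa [h]
  · rw [hin1]
    refine le_min ?_ ?_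
    · have h' := h3 x (hS1 x hx)
      rw [huv x hx] at h'
      exact_mod_cast h'
    rcases hattain0 (T.dist v x + 1) (by omega) with h | ⟨y, hy, hfy, h⟩
    · have := h1 x (hS1 x hx)
      have := hecc x
      omega
    · have hd := hcross y hy x hx
      have h' := hsep x (hS1 x hx) y (hS0 y hy) (by rw [dist_comm]; omega) hfy
      rw [dist_comm, hd] at h'
      push_cast at h'
      rwa [h, show (T.dist v x : ℤ) + 1 + T.dist u y = T.dist u y + 1 + T.dist v x by ring]

end Glue

lemma Compatible.congr {V : Type*} {T : SimpleGraph V} {u : V} {S : Set V}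
    {pin qin pout qout : ℤ} {f g : V → ℕ} (hf : Compatible T u S pin qin pout qout f)
    (hfg : ∀ x ∈ S, g x = f x) : Compatible T u S pin qin pout qout g := by
  obtain ⟨h1, h2, h3, h4⟩ := hf
  refine ⟨fun x hx => ?_, fun x hx y hy => ?_, fun x hx => ?_, fun x hx => ?_⟩
  · rw [hfg x hx]; exact h1 x hx
  · rw [hfg x hx, hfg y hy]; exact h2 x hx y hy
  · rw [hfg x hx]; exact h3 x hx
  · rw [hfg x hx]; exact h4 x hx

/-- Lemma 6: `β((u,i),(p_in,q_in),(p_out,q_out))` equals the maximum of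
`β((u,i-1),(p_in^0,q_in^0),(p_out^0,q_out^0)) + β((v_i,k_i),(p_in^1,q_in^1),(p_out^1,q_out^1))`
over all choices of integers `p_in^0, p_out^0, p_in^1, p_out^1 ∈ [-n,n]` and
`q_in^0, q_out^0, q_in^1, q_out^1 ∈ [1,n]` satisfying conditions (iii), (iv), and (v)
of Lemma 5. -/
theorem stmt13 {V : Type*} [Fintype V] (T : SimpleGraph V) (hT : T.IsTree)
    (n : ℕ) (hn : n = Fintype.card V) (r : V)
    -- u is a vertex with children c 0, ..., c (k-1) in a fixed linear order
    (u : V) (k : ℕ) (c : Fin k → V) (hcinj : Function.Injective c)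
    (hchild : ∀ j, T.Adj u (c j) ∧ T.dist r (c j) = T.dist r u + 1)
    (hallchild : ∀ v, T.Adj u v → T.dist r v = T.dist r u + 1 → ∃ j, c j = v)
    (i : ℕ) (hi1 : 1 ≤ i) (hik : i ≤ k)
    -- vi is the i-th child of u, with children ci 0, ..., ci (ki-1)
    (vi : V) (hvi : vi = c ⟨i - 1, by omega⟩)
    (ki : ℕ) (ci : Fin ki → V) (hciinj : Function.Injective ci)
    (hcichild : ∀ j, T.Adj vi (ci j) ∧ T.dist r (ci j) = T.dist r vi + 1)
    (hciall : ∀ v, T.Adj vi v → T.dist r v = T.dist r vi + 1 → ∃ j, ci j = v)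
    (pin qin pout qout : ℤ)
    (hpin : -(n : ℤ) ≤ pin ∧ pin ≤ n) (hpout : -(n : ℤ) ≤ pout ∧ pout ≤ n)
    (hqin : 1 ≤ qin ∧ qin ≤ n) (hqout : 1 ≤ qout ∧ qout ≤ n) :
    beta T u (subtreeSet T r u c i) pin qin pout qout =
      sSup {s | ∃ pin0 pout0 pin1 pout1 qin0 qout0 qin1 qout1 : ℤ,
        (-(n : ℤ) ≤ pin0 ∧ pin0 ≤ n) ∧ (-(n : ℤ) ≤ pout0 ∧ pout0 ≤ n) ∧
        (-(n : ℤ) ≤ pin1 ∧ pin1 ≤ n) ∧ (-(n : ℤ) ≤ pout1 ∧ pout1 ≤ n) ∧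
        (1 ≤ qin0 ∧ qin0 ≤ n) ∧ (1 ≤ qout0 ∧ qout0 ≤ n) ∧
        (1 ≤ qin1 ∧ qin1 ≤ n) ∧ (1 ≤ qout1 ∧ qout1 ≤ n) ∧
        -- (iii)
        (∀ d : ℤ, 0 ≤ d →
          gfun pin0 qin0 d = min (gfun pin qin d) (gfun pout1 qout1 (d + 1))) ∧
        -- (iv)
        (∀ d : ℤ, 0 ≤ d →
          gfun pin1 qin1 d = min (gfun pin qin (d + 1)) (gfun pout0 qout0 (d + 1))) ∧
        -- (v)
        (∀ d : ℤ, 0 < d →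
          gfun pout qout d ≤ min (gfun pout0 qout0 d) (gfun pout1 qout1 (d + 1))) ∧
        s = beta T u (subtreeSet T r u c (i - 1)) pin0 qin0 pout0 qout0
            + beta T vi (subtreeSet T r vi ci ki) pin1 qin1 pout1 qout1} := by
  classical
  subst hvi hn
  set v := c ⟨i - 1, by omega⟩ with hv
  obtain ⟨hadj, hrv⟩ := hchild ⟨i - 1, by omega⟩
  rw [← hv] at hadj hrv
  set S := subtreeSet T r u c i
  set S₀ := subtreeSet T r u c (i - 1)
  set S₁ := subtreeSet T r v ci ki with hS₁def
  have hmem1 : ∀ y, y ∈ S₁ ↔ T.dist y u = T.dist y v + 1 := fun y =>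
    (mem_subtreeSet_iff_isDesc hT hcichild hciall y).trans (isDesc_iff_of_adj hT hadj hrv)
  have hmem0 : ∀ x ∈ S₀, T.dist x v = T.dist x u + 1 := by
    intro x hx
    have hx1 : ¬ IsDesc T r v x := by
      rcases hx with rfl | ⟨j, hj, hx⟩
      · rw [isDesc_iff_of_adj hT hadj hrv, dist_self]
        omega
      · refine not_isDesc_of_isDesc hT (hchild j).1 (hchild j).2 hadj hrv (fun h => ?_) hx
        have := congrArg Fin.val (hcinj h)
        simp only at this
        omega
    rw [isDesc_iff_of_adj hT hadj hrv] at hx1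
    have := hT.dist_eq_dist_add_one_of_adj x hadj
    omega
  have hS : ∀ x, x ∈ S ↔ x ∈ S₀ ∨ x ∈ S₁ := by
    intro x
    rw [hS₁def, mem_subtreeSet_iff_isDesc hT hcichild hciall x]
    constructor
    · rintro (h | ⟨j, hj, hx⟩)
      · exact Or.inl (Or.inl h)
      · by_cases hji : (j : ℕ) < i - 1
        · exact Or.inl (Or.inr ⟨j, hji, hx⟩)
        · have : j = ⟨i - 1, by omega⟩ := Fin.ext (by simp only; omega)
          rw [this] at hx
          exact Or.inr hx
    · rintro ((h | ⟨j, hj, hx⟩) | h)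
      · exact Or.inl h
      · exact Or.inr ⟨j, by omega, hx⟩
      · exact Or.inr ⟨⟨i - 1, by omega⟩, by simp only; omega, h⟩
  have hdisj : ∀ x ∈ S₀, x ∉ S₁ := fun x hx hx' => by
    have := hmem0 x hx
    have := (hmem1 x).1 hx'
    omega
  have huv : ∀ y ∈ S₁, T.dist u y = T.dist v y + 1 := fun y hy => by
    rw [SimpleGraph.dist_comm, (hmem1 y).1 hy, SimpleGraph.dist_comm]
  have hcross : ∀ x ∈ S₀, ∀ y ∈ S₁, T.dist x y = T.dist u x + 1 + T.dist v y :=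
    fun x hx y hy => hT.dist_eq_of_adj hadj (hmem0 x hx) ((hmem1 y).1 hy)
  have eq_sSup : ∀ A : Set ℕ, beta T u S pin qin pout qout ∈ upperBounds A →
      (BddAbove A → beta T u S pin qin pout qout ≤ sSup A) →
      beta T u S pin qin pout qout = sSup A :=
    fun A hub hle => le_antisymm (hle ⟨_, hub⟩) (csSup_le' hub)
  refine eq_sSup _ ?_ fun hbdd => ?_
  · rintro s ⟨pin0, pout0, pin1, pout1, qin0, qout0, qin1, qout1, -, -, -, -, hqin0, -, hqin1, -,
      hin0, hin1, hout, rfl⟩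
    obtain ⟨f0, hf0z, hf0, hw0⟩ := exists_compatible_sum_eq_beta T u S₀ pin0 pout0 qout0 hqin0.1
    obtain ⟨f1, hf1z, hf1, hw1⟩ := exists_compatible_sum_eq_beta T v S₁ pin1 pout1 qout1 hqin1.1
    rw [hw0, hw1, ← Finset.sum_add_distrib]
    refine sum_le_beta (fun x hx => ?_) (Compatible.glue hS huv hcross hin0 hin1 hout
      (hf0.congr fun x hx => ?_) (hf1.congr fun x hx => ?_))
    · rw [hS, not_or] at hx
      rw [hf0z x hx.1, hf1z x hx.2]
    · rw [hf1z x (hdisj x hx), add_zero]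
    · rw [hf0z x (fun h => hdisj x h hx), zero_add]
  obtain ⟨f, hfz, hf, hw⟩ := exists_compatible_sum_eq_beta T u S pin pout qout hqin.1
  by_cases hne : ∃ x ∈ S, 0 < f x
  · obtain ⟨pin0, pout0, pin1, pout1, qin0, qout0, qin1, qout1, e1, e2, e3, e4, e5, e6, e7, e8,
      hin0, hin1, hout, hf0, hf1⟩ := hf.exists_split hS huv hcross
        (fun x y => hT.connected.dist_lt_card x y) (fun x => hT.connected.ecc_lt_card x)
        hpin hqin hne
    have h0 := sum_le_beta (S := S₀) (f := fun x => if x ∈ S₀ then f x else 0)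
      (fun x hx => if_neg hx) (hf0.congr fun x hx => if_pos hx)
    have h1 := sum_le_beta (S := S₁) (f := fun x => if x ∈ S₁ then f x else 0)
      (fun x hx => if_neg hx) (hf1.congr fun x hx => if_pos hx)
    have hsum : ∑ x, f x = ∑ x, (if x ∈ S₀ then f x else 0) + ∑ x, (if x ∈ S₁ then f x else 0) := by
      rw [← Finset.sum_add_distrib]
      refine Finset.sum_congr rfl fun x _ => ?_
      by_cases hx0 : x ∈ S₀
      · simp [hx0, hdisj x hx0]
      · by_cases hx1 : x ∈ S₁
        · simp [hx0, hx1]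
        · simp [hx0, hx1, hfz x (by rw [hS]; tauto)]
    rw [hw, hsum]
    exact (add_le_add h0 h1).trans (le_csSup hbdd
      ⟨pin0, pout0, pin1, pout1, qin0, qout0, qin1, qout1, e1, e2, e3, e4, e5, e6, e7, e8,
        hin0, hin1, hout, rfl⟩)
  · rw [hw, Finset.sum_eq_zero fun x _ => ?_]
    · exact Nat.zero_le _
    · by_cases hx : x ∈ S
      · exact Nat.eq_zero_of_not_pos fun h => hne ⟨x, hx, h⟩
      · exact hfz x hx
end
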